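/- The 436 × 436 matrix GS([A1], [A2], [A3], [A4]) built by substituting the circulant matrices [A1], [A2], [A3], [A4] into the Goethals–Seidel array is a skew-Hadamard matrix of order 436; that is, all its entries are ±1, it satisfies M · Mᵀ = 436 · I_436, and M + Mᵀ = 2 · I_436. -/

import Mathlib

open Finset Matrix

/-- The subgroup H of order 3 of the multiplicative group of `ZMod 109`. -/
def H : Finset (ZMod 109) := {1, 45, 63}

/-- Representatives of the even-indexed orbits. -/
def rep : List (ZMod 109) := [1, 2, 3, 4, 5, 6, 8, 9, 10, 11, 13, 15, 16, 18, 20, 23, 25, 30]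

/-- The orbits `α i`: `α (2*i) = rep[i] • H` and `α (2*i+1) = -α (2*i)`. -/
def alpha (i : ℕ) : Finset (ZMod 109) :=
  if i % 2 = 0 then H.image (fun h => rep.getD (i / 2) 0 * h)
  else (H.image (fun h => rep.getD (i / 2) 0 * h)).image (fun x => -x)

def A1 : Finset (ZMod 109) := ({0, 2, 5, 7, 8, 10, 12, 15, 16, 19, 20, 23, 24, 26, 29, 30, 33, 34} : Finset ℕ).biUnion alpha
def A2 : Finset (ZMod 109) := ({4, 5, 6, 7, 11, 15, 18, 19, 20, 22, 25, 30, 32, 33, 35} : Finset ℕ).biUnion alpha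
def A3 : Finset (ZMod 109) := ({0, 1, 5, 6, 9, 10, 11, 14, 17, 20, 24, 26, 27, 28, 29, 31, 32} : Finset ℕ).biUnion alpha
def A4 : Finset (ZMod 109) := ({0, 3, 4, 6, 7, 9, 10, 12, 13, 22, 24, 25, 26, 27, 28, 29, 31, 33, 35} : Finset ℕ).biUnion alpha

/-- The circulant {±1}-matrix `[X]` associated to `X ⊆ ZMod 109`. -/
def circ (X : Finset (ZMod 109)) : Matrix (ZMod 109) (ZMod 109) ℤ :=
  Matrix.of fun i j => if j - i ∈ X then -1 else 1

/-- The back-diagonal permutation matrix `R`. -/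
def R : Matrix (ZMod 109) (ZMod 109) ℤ :=
  Matrix.of fun i j => if i + j = (108 : ZMod 109) then 1 else 0

/-- The Goethals–Seidel array. -/
def GS (P1 P2 P3 P4 : Matrix (ZMod 109) (ZMod 109) ℤ) :
    Matrix (Fin 4 × ZMod 109) (Fin 4 × ZMod 109) ℤ :=
  Matrix.of fun p q =>
    (![![P1, P2 * R, P3 * R, P4 * R],
       ![-(P2 * R), P1, -(P4ᵀ * R), P3ᵀ * R],
       ![-(P3 * R), P4ᵀ * R, P1, -(P2ᵀ * R)],
       ![-(P4 * R), -(P3ᵀ * R), P2ᵀ * R, P1]] p.1 q.1) p.2 q.2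

/-- The `±1`-valued indicator function of the complement of `X`, reflected through `0`. -/
def reflSign (X : Finset (ZMod 109)) (x : ZMod 109) : ℤ := if -x ∈ X then -1 else 1

theorem circ_eq_circulant (X : Finset (ZMod 109)) : circ X = circulant (reflSign X) := by
  ext i j
  simp [circ, reflSign, circulant_apply]

theorem reflSign_eq_or (X : Finset (ZMod 109)) (x : ZMod 109) :
    reflSign X x = 1 ∨ reflSign X x = -1 := by
  unfold reflSign
  split_ifs <;> simp

theorem mul_R_apply (P : Matrix (ZMod 109) (ZMod 109) ℤ) (i j : ZMod 109) :
    (P * R) i j = P i (108 - j) := by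
  simp [Matrix.mul_apply, R, ← eq_sub_iff_add_eq]

theorem R_mul_apply (P : Matrix (ZMod 109) (ZMod 109) ℤ) (i j : ZMod 109) :
    (R * P) i j = P (108 - i) j := by
  simp [Matrix.mul_apply, R, ← eq_sub_iff_add_eq']

theorem R_mul_R : R * R = 1 := by
  ext i j
  rw [mul_R_apply]
  simp [R, Matrix.one_apply, ← add_sub_assoc, sub_eq_iff_eq_add, add_comm]

theorem R_mul_circulant (v : ZMod 109 → ℤ) :
    R * circulant v = circulant (fun x => v (-x)) * R := by
  ext i j
  rw [mul_R_apply, R_mul_apply, circulant_apply, circulant_apply]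
  congr 1
  ring

theorem transpose_circulant_mul_R (v : ZMod 109 → ℤ) :
    (circulant v * R)ᵀ = circulant v * R := by
  ext i j
  rw [transpose_apply, mul_R_apply, mul_R_apply, circulant_apply, circulant_apply]
  congr 1
  ring

theorem circulant_mul_R_mul_circulant (v w : ZMod 109 → ℤ) :
    circulant v * R * circulant w = circulant v * circulant (fun x => w (-x)) * R := by
  rw [Matrix.mul_assoc, R_mul_circulant, Matrix.mul_assoc]

theorem mul_R_mul_R (P : Matrix (ZMod 109) (ZMod 109) ℤ) : P * R * R = P := by
  rw [Matrix.mul_assoc, R_mul_R, Matrix.mul_one]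

/-- The blocks of the Goethals–Seidel array. -/
def gsBlock (P₁ P₂ P₃ P₄ : Matrix (ZMod 109) (ZMod 109) ℤ) (a b : Fin 4) :
    Matrix (ZMod 109) (ZMod 109) ℤ :=
  ![![P₁, P₂ * R, P₃ * R, P₄ * R],
    ![-(P₂ * R), P₁, -(P₄ᵀ * R), P₃ᵀ * R],
    ![-(P₃ * R), P₄ᵀ * R, P₁, -(P₂ᵀ * R)],
    ![-(P₄ * R), -(P₃ᵀ * R), P₂ᵀ * R, P₁]] a b

theorem GS_apply (P₁ P₂ P₃ P₄ : Matrix (ZMod 109) (ZMod 109) ℤ) (a b : Fin 4) (i j : ZMod 109) :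
    GS P₁ P₂ P₃ P₄ (a, i) (b, j) = gsBlock P₁ P₂ P₃ P₄ a b i j := rfl

/-- The Goethals–Seidel array of four `±1` circulants has entries `±1`. -/
theorem GS_circulant_eq_or {v₁ v₂ v₃ v₄ : ZMod 109 → ℤ}
    (h₁ : ∀ x, v₁ x = 1 ∨ v₁ x = -1) (h₂ : ∀ x, v₂ x = 1 ∨ v₂ x = -1)
    (h₃ : ∀ x, v₃ x = 1 ∨ v₃ x = -1) (h₄ : ∀ x, v₄ x = 1 ∨ v₄ x = -1)
    (p q : Fin 4 × ZMod 109) :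
    GS (circulant v₁) (circulant v₂) (circulant v₃) (circulant v₄) p q = 1 ∨
      GS (circulant v₁) (circulant v₂) (circulant v₃) (circulant v₄) p q = -1 := by
  obtain ⟨a, i⟩ := p
  obtain ⟨b, j⟩ := q
  have hR {P : Matrix (ZMod 109) (ZMod 109) ℤ} (hP : ∀ i j, P i j = 1 ∨ P i j = -1) :
      ∀ i j, (P * R) i j = 1 ∨ (P * R) i j = -1 := fun i j => by
    rw [mul_R_apply]
    exact hP _ _
  have hneg {P : Matrix (ZMod 109) (ZMod 109) ℤ} (hP : ∀ i j, P i j = 1 ∨ P i j = -1) :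
      ∀ i j, (-P) i j = 1 ∨ (-P) i j = -1 := fun i j =>
    (hP i j).symm.imp (fun h => by rw [neg_apply, h, neg_neg]) (fun h => by rw [neg_apply, h])
  have hc {v : ZMod 109 → ℤ} (hv : ∀ x, v x = 1 ∨ v x = -1) (i j : ZMod 109) :
      circulant v i j = 1 ∨ circulant v i j = -1 := hv _
  have ht {v : ZMod 109 → ℤ} (hv : ∀ x, v x = 1 ∨ v x = -1) (i j : ZMod 109) :
      (circulant v)ᵀ i j = 1 ∨ (circulant v)ᵀ i j = -1 := hv _
  rw [GS_apply]
  fin_cases a <;> fin_cases b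
  exacts [hc h₁ i j, hR (hc h₂) i j, hR (hc h₃) i j, hR (hc h₄) i j,
    hneg (hR (hc h₂)) i j, hc h₁ i j, hneg (hR (ht h₄)) i j, hR (ht h₃) i j,
    hneg (hR (hc h₃)) i j, hR (ht h₄) i j, hc h₁ i j, hneg (hR (ht h₂)) i j,
    hneg (hR (hc h₄)) i j, hneg (hR (ht h₃)) i j, hR (ht h₂) i j, hc h₁ i j]

/-- The block rows of the Goethals–Seidel array of four circulants satisfying the autocorrelation
condition are orthogonal. -/
theorem sum_gsBlock_circulant_mul_transpose {v₁ v₂ v₃ v₄ : ZMod 109 → ℤ} {c : ℤ}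
    (h : circulant v₁ * (circulant v₁)ᵀ + circulant v₂ * (circulant v₂)ᵀ +
      circulant v₃ * (circulant v₃)ᵀ + circulant v₄ * (circulant v₄)ᵀ = c • 1) (a b : Fin 4) :
    ∑ k, gsBlock (circulant v₁) (circulant v₂) (circulant v₃) (circulant v₄) a k *
      (gsBlock (circulant v₁) (circulant v₂) (circulant v₃) (circulant v₄) b k)ᵀ =
    if a = b then c • 1 else 0 := by
  rw [← h]
  simp only [transpose_circulant, Fin.sum_univ_four, gsBlock]
  fin_cases a <;> fin_cases b <;>
    simp only [Fin.zero_eta, Fin.mk_one, Fin.reduceFinMk, Matrix.cons_val, if_true, Fin.reduceEq,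
      if_false, transpose_neg, transpose_circulant_mul_R, transpose_circulant, Matrix.mul_neg,
      Matrix.neg_mul, neg_neg, circulant_mul_R_mul_circulant, mul_R_mul_R,
      ← Matrix.mul_assoc, circulant_mul_comm] <;>
    abel

/-- The Goethals–Seidel array of four circulants satisfying the autocorrelation condition has
orthogonal rows. -/
theorem GS_circulant_mul_transpose {v₁ v₂ v₃ v₄ : ZMod 109 → ℤ} {c : ℤ}
    (h : circulant v₁ * (circulant v₁)ᵀ + circulant v₂ * (circulant v₂)ᵀ +
      circulant v₃ * (circulant v₃)ᵀ + circulant v₄ * (circulant v₄)ᵀ = c • 1) :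
    GS (circulant v₁) (circulant v₂) (circulant v₃) (circulant v₄) *
      (GS (circulant v₁) (circulant v₂) (circulant v₃) (circulant v₄))ᵀ = c • 1 := by
  ext ⟨a, i⟩ ⟨b, j⟩
  have hab := congrFun₂ (sum_gsBlock_circulant_mul_transpose h a b) i j
  simp only [Matrix.sum_apply, Matrix.mul_apply, transpose_apply] at hab
  simp only [Matrix.mul_apply, transpose_apply, Fintype.sum_prod_type, GS_apply, hab]
  by_cases hab' : a = b <;> simp [hab', Matrix.one_apply]

/-- The Goethals–Seidel array is skew as soon as its first block is. -/
theorem GS_circulant_add_transpose {v₁ v₂ v₃ v₄ : ZMod 109 → ℤ} {c : ℤ}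
    (h : circulant v₁ + (circulant v₁)ᵀ = c • 1) :
    GS (circulant v₁) (circulant v₂) (circulant v₃) (circulant v₄) +
      (GS (circulant v₁) (circulant v₂) (circulant v₃) (circulant v₄))ᵀ = c • 1 := by
  have hblock (a b : Fin 4) :
      gsBlock (circulant v₁) (circulant v₂) (circulant v₃) (circulant v₄) a b +
        (gsBlock (circulant v₁) (circulant v₂) (circulant v₃) (circulant v₄) b a)ᵀ =
      if a = b then c • 1 else 0 := by
    rw [← h]
    simp only [transpose_circulant, gsBlock]
    fin_cases a <;> fin_cases b <;>
      simp only [Fin.zero_eta, Fin.mk_one, Fin.reduceFinMk, Matrix.cons_val, if_true,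
        Fin.reduceEq, if_false, transpose_neg, transpose_circulant_mul_R, transpose_circulant,
        neg_add_cancel, add_neg_cancel]
  ext ⟨a, i⟩ ⟨b, j⟩
  have hab := congrFun₂ (hblock a b) i j
  rw [Matrix.add_apply, transpose_apply] at hab
  rw [Matrix.add_apply, transpose_apply, GS_apply, GS_apply, hab]
  by_cases hab' : a = b <;> simp [hab', Matrix.one_apply]

/-- The `±1` sequence whose `-1`s are at the binary digits `1` of `m`. -/
def bitSign (m n : ℕ) : ℤ := if m.testBit n then -1 else 1

/-- The binary indicator of `A1`. -/
def mask1 : ℕ := 123459675551352000816092535023078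

/-- The binary indicator of `A2`. -/
def mask2 : ℕ := 133430319674679116411051224115224

/-- The binary indicator of `A3`. -/
def mask3 : ℕ := 441819033027258125526959733944914

/-- The binary indicator of `A4`. -/
def mask4 : ℕ := 230730465453557616443923388797274

theorem sum_bitSign_eq : ∀ d < 109, ∑ x ∈ range 109,
    (bitSign mask1 x * bitSign mask1 ((x + d) % 109) +
      bitSign mask2 x * bitSign mask2 ((x + d) % 109) +
      bitSign mask3 x * bitSign mask3 ((x + d) % 109) +
      bitSign mask4 x * bitSign mask4 ((x + d) % 109)) =
    if d = 0 then 436 else 0 := by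
  decide +kernel

theorem reflSign_A1 : ∀ x, reflSign A1 x = bitSign mask1 (-x).val := by decide +kernel

theorem reflSign_A2 : ∀ x, reflSign A2 x = bitSign mask2 (-x).val := by decide +kernel

theorem reflSign_A3 : ∀ x, reflSign A3 x = bitSign mask3 (-x).val := by decide +kernel

theorem reflSign_A4 : ∀ x, reflSign A4 x = bitSign mask4 (-x).val := by decide +kernel

theorem circulant_reflSign_A1_add_transpose :
    circulant (reflSign A1) + (circulant (reflSign A1))ᵀ = (2 : ℤ) • 1 := by
  have key : ∀ x, reflSign A1 x + reflSign A1 (-x) = if x = 0 then 2 else 0 := by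
    decide +kernel
  ext i j
  have hij := key (i - j)
  rw [neg_sub] at hij
  simp only [Matrix.add_apply, transpose_apply, circulant_apply, hij, Matrix.smul_apply,
    Matrix.one_apply, sub_eq_zero, smul_eq_mul, mul_ite, mul_one, mul_zero]

theorem sum_reflSign_eq (d : ZMod 109) : ∑ x,
    (reflSign A1 x * reflSign A1 (x + d) + reflSign A2 x * reflSign A2 (x + d) +
      reflSign A3 x * reflSign A3 (x + d) + reflSign A4 x * reflSign A4 (x + d)) =
    if d = 0 then 436 else 0 := by
  have hs (f : ℕ → ℤ) : ∑ x ∈ range 109, f x = ∑ x : ZMod 109, f x.val :=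
    (Fin.sum_univ_eq_sum_range f 109).symm
  have key := sum_bitSign_eq (-d).val (ZMod.val_lt _)
  simp only [hs, ← ZMod.val_add, ZMod.val_eq_zero, neg_eq_zero] at key
  rw [← key, ← Equiv.sum_comp (Equiv.neg (ZMod 109))]
  simp only [reflSign_A1, reflSign_A2, reflSign_A3, reflSign_A4, Equiv.neg_apply, neg_add,
    neg_neg]

theorem sum_circulant_reflSign_mul_transpose :
    circulant (reflSign A1) * (circulant (reflSign A1))ᵀ +
      circulant (reflSign A2) * (circulant (reflSign A2))ᵀ +
      circulant (reflSign A3) * (circulant (reflSign A3))ᵀ +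
      circulant (reflSign A4) * (circulant (reflSign A4))ᵀ = (436 : ℤ) • 1 := by
  ext i j
  have key := sum_reflSign_eq (j - i)
  rw [← Equiv.sum_comp (Equiv.subLeft i)] at key
  simp only [Equiv.subLeft_apply, sub_add_sub_cancel', sub_eq_zero] at key
  simp only [Matrix.add_apply, Matrix.mul_apply, transpose_apply, circulant_apply,
    ← Finset.sum_add_distrib, Matrix.smul_apply, Matrix.one_apply, key, eq_comm (a := j),
    smul_eq_mul, mul_ite, mul_one, mul_zero]

theorem gs_skew_hadamard_A :
    (∀ p q, GS (circ A1) (circ A2) (circ A3) (circ A4) p q = 1 ∨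
            GS (circ A1) (circ A2) (circ A3) (circ A4) p q = -1) ∧
    GS (circ A1) (circ A2) (circ A3) (circ A4) *
      (GS (circ A1) (circ A2) (circ A3) (circ A4))ᵀ = (436 : ℤ) • 1 ∧
    GS (circ A1) (circ A2) (circ A3) (circ A4) +
      (GS (circ A1) (circ A2) (circ A3) (circ A4))ᵀ = (2 : ℤ) • 1 := by
  simp only [circ_eq_circulant]
  exact ⟨GS_circulant_eq_or (reflSign_eq_or _) (reflSign_eq_or _) (reflSign_eq_or _)
    (reflSign_eq_or _), GS_circulant_mul_transpose sum_circulant_reflSign_mul_transpose,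
    GS_circulant_add_transpose circulant_reflSign_A1_add_transpose⟩
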